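/- arXiv:1503.03246 — 3 statements merged into one kernel-verified Lean document; each statement's English description precedes it below -/
import Mathlib

section
/- Let X be a homogeneous compact metric space and T : X → X a homeomorphism. Then the topological entropy of F_T on H(X,X) is at least as large as the topological entropy of T on X. -/
open Set Filter Topology

/-- `E` is an `(n, ε)`-separated set for the map `S`: any two distinct points of `E` are more
than `ε` apart in the dynamical metric `max_{0 ≤ j < n} dist (S^j x) (S^j y)`. -/
def IsDynSep {Z : Type*} [PseudoMetricSpace Z] (S : Z → Z) (n : ℕ) (ε : ℝ) (E : Set Z) : Prop :=
  ∀ x ∈ E, ∀ y ∈ E, x ≠ y → ∃ j < n, ε < dist (S^[j] x) (S^[j] y)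

/-- The maximal cardinality `sep(n, ε; K)` of an `(n, ε)`-separated subset of `K`. -/
noncomputable def sepNum {Z : Type*} [PseudoMetricSpace Z] (S : Z → Z) (n : ℕ) (ε : ℝ)
    (K : Set Z) : ℕ :=
  sSup {m : ℕ | ∃ E : Finset Z, ↑E ⊆ K ∧ IsDynSep S n ε ↑E ∧ E.card = m}

/-- The topological entropy of `S` on the set `K`:
`lim_{ε → 0} limsup_n (1/n) log sep(n, ε; K)`; the limit as `ε → 0` is realized as the
supremum over `ε > 0`, the quantity being monotone in `ε`. -/
noncomputable def entropyOnSet {Z : Type*} [PseudoMetricSpace Z] (S : Z → Z) (K : Set Z) :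
    EReal :=
  ⨆ (ε : ℝ) (_ : 0 < ε),
    Filter.atTop.limsup fun n : ℕ => ((Real.log (sepNum S n ε K) / n : ℝ) : EReal)

/-- The topological entropy of the restriction of `S` to a subset `A` of its domain:
the supremum of the entropies on all compact subsets of `A`. -/
noncomputable def entropyOn {Z : Type*} [PseudoMetricSpace Z] (S : Z → Z) (A : Set Z) : EReal :=
  ⨆ (K : Set Z) (_ : IsCompact K) (_ : K ⊆ A), entropyOnSet S K

/-- The topological entropy of `S`: the supremum of the entropies on all compact sets. -/
noncomputable def dynEntropy {Z : Type*} [PseudoMetricSpace Z] (S : Z → Z) : EReal :=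
  ⨆ (K : Set Z) (_ : IsCompact K), entropyOnSet S K

/-- The set `H(X,X)` of self-homeomorphisms of `X`, viewed inside `C(X,X)` (so that, for `X`
compact metric, it inherits the uniform metric `D(φ,ψ) = sup_x d(φ x, ψ x)`). -/
def HSet (X : Type*) [TopologicalSpace X] : Set C(X, X) := {f | IsHomeomorph f}

/-- The functional envelope map `F_T : φ ↦ T ∘ φ` on `C(X,X)`. -/
def envMap {X : Type*} [TopologicalSpace X] (T : X ≃ₜ X) : C(X, X) → C(X, X) :=
  fun φ => (T : C(X, X)).comp φ

/-! ### Homeomorphisms as pairs (map, inverse), a complete metric space -/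

abbrev HPair (X : Type*) [TopologicalSpace X] : Type _ :=
  {p : C(X, X) × C(X, X) // (∀ x, p.1 (p.2 x) = x) ∧ ∀ x, p.2 (p.1 x) = x}

namespace HPair

set_option linter.unusedSectionVars false

variable {X : Type*} [MetricSpace X] [CompactSpace X]

def one : HPair X := ⟨(ContinuousMap.id X, ContinuousMap.id X), by simp⟩

def mul (p q : HPair X) : HPair X :=
  ⟨(p.1.1.comp q.1.1, q.1.2.comp p.1.2), by simp [p.2.1, q.2.1], by simp [p.2.2, q.2.2]⟩

def inv (p : HPair X) : HPair X := ⟨(p.1.2, p.1.1), p.2.2, p.2.1⟩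

def ofHomeo (f : X ≃ₜ X) : HPair X := ⟨((f : C(X, X)), (f.symm : C(X, X))), by simp, by simp⟩

def toHomeo (p : HPair X) : X ≃ₜ X where
  toFun := p.1.1
  invFun := p.1.2
  left_inv := p.2.2
  right_inv := p.2.1
  continuous_toFun := p.1.1.continuous
  continuous_invFun := p.1.2.continuous

def Small (p : HPair X) (ε : ℝ) : Prop := ∀ x, dist (p.1.1 x) x < ε

def orb (ε : ℝ) (z : X) : Set X := {y | ∃ p : HPair X, Small p ε ∧ p.1.1 z = y}

lemma small_inv {p : HPair X} {ε : ℝ} (h : Small p ε) : Small (inv p) ε := by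
  intro x
  have := h (p.1.2 x)
  rw [p.2.1, dist_comm] at this
  exact this

lemma small_mul {p q : HPair X} {ε δ : ℝ} (h : Small p ε) (h' : Small q δ) :
    Small (mul p q) (ε + δ) := by
  intro x
  have h1 := h (q.1.1 x)
  have h2 := h' x
  calc dist (p.1.1 (q.1.1 x)) x ≤ dist (p.1.1 (q.1.1 x)) (q.1.1 x) + dist (q.1.1 x) x :=
        dist_triangle _ _ _
    _ < _ := by linarith

lemma isClosed_set : IsClosed {p : C(X, X) × C(X, X) |
    (∀ x, p.1 (p.2 x) = x) ∧ ∀ x, p.2 (p.1 x) = x} := by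
  have : {p : C(X, X) × C(X, X) | (∀ x, p.1 (p.2 x) = x) ∧ ∀ x, p.2 (p.1 x) = x} =
      {p | p.1.comp p.2 = ContinuousMap.id X} ∩ {p | p.2.comp p.1 = ContinuousMap.id X} := by
    ext p
    simp [ContinuousMap.ext_iff]
  rw [this]
  refine IsClosed.inter ?_ ?_
  · exact isClosed_eq (continuous_fst.compCM continuous_snd) continuous_const
  · exact isClosed_eq (continuous_snd.compCM continuous_fst) continuous_const

instance : CompleteSpace (HPair X) := isClosed_set.completeSpace_coe

lemma dist_lt {p q : HPair X} {ε : ℝ} (hε : 0 < ε) (h1 : ∀ x, dist (p.1.1 x) (q.1.1 x) < ε)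
    (h2 : ∀ x, dist (p.1.2 x) (q.1.2 x) < ε) : dist p q < ε := by
  rw [Subtype.dist_eq, Prod.dist_eq]
  exact max_lt ((ContinuousMap.dist_lt_iff hε).2 h1) ((ContinuousMap.dist_lt_iff hε).2 h2)

lemma dist_apply_le (p q : HPair X) (x : X) : dist (p.1.1 x) (q.1.1 x) ≤ dist p q := by
  rw [Subtype.dist_eq, Prod.dist_eq]
  exact (ContinuousMap.dist_apply_le_dist x).trans (le_max_left _ _)

/-- small left multiplication moves little -/
lemma exists_small (p : HPair X) {ε : ℝ} (hε : 0 < ε) :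
    ∃ η > 0, η ≤ ε ∧ ∀ g, Small g η → dist (mul g p) p < ε := by
  have huc : UniformContinuous p.1.2 := CompactSpace.uniformContinuous_of_continuous p.1.2.continuous
  obtain ⟨δ, hδ, h⟩ := Metric.uniformContinuous_iff.1 huc ε hε
  refine ⟨min δ ε, lt_min hδ hε, min_le_right _ _, fun g hg => dist_lt hε ?_ ?_⟩
  · intro x
    exact (hg (p.1.1 x)).trans_le (min_le_right _ _)
  · intro x
    exact h ((small_inv hg x).trans_le (min_le_left _ _))

lemma closure_orb_mem_nhds [Nonempty X] (hhom : ∀ x y : X, ∃ f : X ≃ₜ X, f x = y) (z : X) {ε : ℝ}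
    (hε : 0 < ε) : closure (orb ε z) ∈ 𝓝 z := by
  obtain ⟨s, hsc, hsd⟩ := TopologicalSpace.exists_countable_dense (HPair X)
  have hcov : (⋃ g : s, closure (g.1.1.1 '' orb (ε / 2) z)) = univ := by
    refine eq_univ_of_forall fun y => ?_
    obtain ⟨f, hf⟩ := hhom z y
    obtain ⟨g, hg, hgs⟩ := hsd.exists_dist_lt (ofHomeo f) (half_pos hε)
    refine mem_iUnion.2 ⟨⟨g, hg⟩, subset_closure ⟨g.1.2 y, ?_, g.2.1 y⟩⟩
    refine ⟨mul (inv g) (ofHomeo f), ?_, ?_⟩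
    · have : Small (mul (inv (ofHomeo f)) g) (ε / 2) := by
        intro x
        have h1 : dist ((ofHomeo f).1.2 (g.1.1 x)) (g.1.2 (g.1.1 x)) ≤ dist (ofHomeo f) g := by
          rw [Subtype.dist_eq, Prod.dist_eq]
          exact (ContinuousMap.dist_apply_le_dist _).trans (le_max_right _ _)
        rw [g.2.2] at h1
        exact h1.trans_lt hgs
      exact small_inv this
    · show g.1.2 (f z) = _
      rw [hf]
  have : Countable s := hsc.to_subtype
  obtain ⟨⟨g, hg⟩, w, hw⟩ := nonempty_interior_of_iUnion_of_closed
    (fun g : s => isClosed_closure) hcov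
  -- pull back by `g`
  have hmem : interior (closure (g.1.1 '' orb (ε / 2) z)) ∈ 𝓝 w := isOpen_interior.mem_nhds hw
  obtain ⟨_, hv1, v, ⟨u, hu, rfl⟩, rfl⟩ :=
    mem_closure_iff_nhds.1 (interior_subset hw) _ hmem
  -- the map `g u` sends `z` into the interior
  let k : HPair X := mul g u
  have hk : k.1.1 ⁻¹' (interior (closure (g.1.1 '' orb (ε / 2) z))) ∈ 𝓝 z :=
    k.1.1.continuous.continuousAt.preimage_mem_nhds (isOpen_interior.mem_nhds hv1)
  refine mem_of_superset hk fun y hy => ?_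
  have hy' : k.1.1 y ∈ closure (g.1.1 '' orb (ε / 2) z) := interior_subset hy
  have h2 : k.1.2 (k.1.1 y) ∈ closure (k.1.2 '' (g.1.1 '' orb (ε / 2) z)) :=
    image_closure_subset_closure_image k.1.2.continuous (mem_image_of_mem _ hy')
  rw [k.2.2] at h2
  refine closure_mono ?_ h2
  rintro _ ⟨_, ⟨_, ⟨q, hq, rfl⟩, rfl⟩, rfl⟩
  refine ⟨mul (inv u) q, ?_, ?_⟩
  · have := small_mul (small_inv hu) hq
    rwa [add_halves] at this
  · show u.1.2 (q.1.1 z) = u.1.2 (g.1.2 (g.1.1 (q.1.1 z)))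
    rw [g.2.2]

lemma dist_le_of_mem_closure_orb {ε : ℝ} {a b : X} (h : b ∈ closure (orb ε a)) :
    dist b a ≤ ε := by
  have : closure (orb ε a) ⊆ Metric.closedBall a ε := by
    refine closure_minimal ?_ Metric.isClosed_closedBall
    rintro _ ⟨p, hp, rfl⟩
    exact (hp a).le
  exact this h

/-- one back-and-forth step -/
lemma step [Nonempty X] (hhom : ∀ x y : X, ∃ f : X ≃ₜ X, f x = y) (x y : X)
    (P Q : HPair X) (ε c c' : ℝ) (hc : 0 < c) (hc' : 0 < c')
    (hP : ∀ g, Small g ε → dist (mul g P) P < c) (hPQ : Q.1.1 y ∈ closure (orb ε (P.1.1 x))) :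
    ∃ (P' Q' : HPair X) (ε' : ℝ), ε' ≤ c' ∧ dist P' P < c ∧ dist Q' Q < c ∧
      (∀ g, Small g ε' → dist (mul g P') P' < c') ∧ Q'.1.1 y ∈ closure (orb ε' (P'.1.1 x)) := by
  obtain ⟨η, hη, -, hηQ⟩ := exists_small Q hc
  obtain ⟨_, h1, g, hg, rfl⟩ := mem_closure_iff_nhds.1 hPQ _ (closure_orb_mem_nhds hhom _ hη)
  obtain ⟨ε', hε', hεc, hεP⟩ := exists_small (mul g P) hc'
  obtain ⟨_, h2, h, hh, rfl⟩ := mem_closure_iff_nhds.1 h1 _ (closure_orb_mem_nhds hhom _ hε')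
  exact ⟨mul g P, mul h Q, ε', hεc, hP g hg, hηQ h hh, hεP, h2⟩

/-- The theorem of Effros -/
lemma orb_mem_nhds [Nonempty X] (hhom : ∀ x y : X, ∃ f : X ≃ₜ X, f x = y) (x : X) {η : ℝ}
    (hη : 0 < η) : orb η x ∈ 𝓝 x := by
  set c : ℕ → ℝ := fun n => η / 8 / 2 / 2 ^ n with hcdef
  have hc : ∀ n, 0 < c n := fun n => by positivity
  obtain ⟨ε₀, hε₀, hε₀c, hε₀P⟩ := exists_small (one : HPair X) (hc 0)
  refine mem_of_superset (closure_orb_mem_nhds hhom x hε₀) fun y hy => ?_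
  let St : ℕ → Type _ := fun n => {s : HPair X × HPair X × ℝ // s.2.2 ≤ c n ∧
    (∀ g, Small g s.2.2 → dist (mul g s.1) s.1 < c n) ∧
    s.2.1.1.1 y ∈ closure (orb s.2.2 (s.1.1.1 x))}
  have hstep : ∀ n (s : St n), ∃ s' : St (n + 1),
      dist s'.1.1 s.1.1 < c n ∧ dist s'.1.2.1 s.1.2.1 < c n := by
    rintro n ⟨⟨P, Q, ε⟩, h1, h2, h3⟩
    obtain ⟨P', Q', ε', a1, a2, a3, a4, a5⟩ :=
      step hhom x y P Q ε (c n) (c (n + 1)) (hc n) (hc _) h2 h3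
    exact ⟨⟨⟨P', Q', ε'⟩, a1, a4, a5⟩, a2, a3⟩
  choose nxt hn1 hn2 using hstep
  let seq : ∀ n, St n := fun n => Nat.rec (motive := St) ⟨⟨one, one, ε₀⟩, hε₀c, hε₀P, hy⟩
    (fun n s => nxt n s) n
  have hP : ∀ n, dist (seq n).1.1 (seq (n + 1)).1.1 ≤ c n := fun n => by
    rw [dist_comm]; exact (hn1 n (seq n)).le
  have hQ : ∀ n, dist (seq n).1.2.1 (seq (n + 1)).1.2.1 ≤ c n := fun n => by
    rw [dist_comm]; exact (hn2 n (seq n)).le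
  obtain ⟨P, hPl⟩ := cauchySeq_tendsto_of_complete (cauchySeq_of_le_geometric_two hP)
  obtain ⟨Q, hQl⟩ := cauchySeq_tendsto_of_complete (cauchySeq_of_le_geometric_two hQ)
  have hP0 : dist one P ≤ η / 8 := dist_le_of_le_geometric_two_of_tendsto₀ hP hPl
  have hQ0 : dist one Q ≤ η / 8 := dist_le_of_le_geometric_two_of_tendsto₀ hQ hQl
  have hev : ∀ z : X, Continuous fun p : HPair X => p.1.1 z := fun z =>
    (continuous_eval_const z).comp (continuous_fst.comp continuous_subtype_val)
  have hPx := ((hev x).tendsto P).comp hPl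
  have hQy := ((hev y).tendsto Q).comp hQl
  have hc0 : Tendsto c atTop (𝓝 0) := by
    have := (tendsto_pow_atTop_nhds_zero_of_lt_one (r := (1 / 2 : ℝ)) (by norm_num)
      (by norm_num)).const_mul (η / 8 / 2)
    simpa [hcdef, div_eq_mul_inv] using this
  have hd : dist (Q.1.1 y) (P.1.1 x) ≤ 0 :=
    le_of_tendsto_of_tendsto' (hQy.dist hPx) hc0 fun n =>
      (dist_le_of_mem_closure_orb (seq n).2.2.2).trans (seq n).2.1
  have heq : Q.1.1 y = P.1.1 x := dist_le_zero.1 hd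
  have small : ∀ R : HPair X, dist one R ≤ η / 8 → Small R (η / 2) := by
    intro R hR z
    have := dist_apply_le one R z
    rw [dist_comm] at this
    exact (this.trans hR).trans_lt (by linarith)
  refine ⟨mul (inv Q) P, ?_, ?_⟩
  · have := small_mul (small_inv (small Q hQ0)) (small P hP0)
    rwa [add_halves] at this
  · show Q.1.2 (P.1.1 x) = y
    rw [← heq, Q.2.2]

lemma isOpen_ev [Nonempty X] (hhom : ∀ x y : X, ∃ f : X ≃ₜ X, f x = y) (x : X)
    (p : HPair X) {ε : ℝ} (hε : 0 < ε) :
    (fun q : HPair X => q.1.1 x) '' Metric.ball p ε ∈ 𝓝 (p.1.1 x) := by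
  obtain ⟨η, hη, -, h⟩ := exists_small p hε
  refine mem_of_superset (orb_mem_nhds hhom (p.1.1 x) hη) ?_
  rintro _ ⟨g, hg, rfl⟩
  exact ⟨mul g p, h g hg, rfl⟩

end HPair

/-- Open maps from complete metric spaces onto compact metric spaces are compact-covering. -/
lemma exists_compact_image_univ {M X : Type*} [MetricSpace M] [CompleteSpace M] [MetricSpace X]
    [CompactSpace X] (f : M → X) (hf : Continuous f) (hs : Function.Surjective f)
    (ho : ∀ p ε, 0 < ε → f '' Metric.ball p ε ∈ 𝓝 (f p)) :
    ∃ K : Set M, IsCompact K ∧ f '' K = univ := by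
  classical
  set c : ℕ → ℝ := fun n => 1 / 2 / 2 ^ n with hcdef
  have hc : ∀ n, 0 < c n := fun n => by positivity
  -- subdivision lemma
  have sub : ∀ (C : Set X) (A : Set M) (r : ℝ), 0 < r → IsCompact C → C ⊆ f '' A →
      ∃ S : Finset (Set X × M), (∀ s ∈ S, IsCompact s.1 ∧ s.1 ⊆ f '' Metric.ball s.2 r) ∧
        ∀ x ∈ C, ∃ s ∈ S, x ∈ s.1 ∧ s.2 ∈ A := by
    intro C A r hr hC hCA
    have : ∀ y : X, ∃ (m : M) (V : Set X), y ∈ C → (m ∈ A ∧ V ∈ 𝓝 y ∧ IsCompact V ∧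
        V ⊆ f '' Metric.ball m r) := by
      intro y
      by_cases hy : y ∈ C
      · obtain ⟨m, hm, rfl⟩ := hCA hy
        obtain ⟨δ, hδ, hb⟩ := Metric.nhds_basis_closedBall.mem_iff.1 (ho m r hr)
        exact ⟨m, Metric.closedBall (f m) δ, fun _ => ⟨hm, Metric.closedBall_mem_nhds _ hδ,
          Metric.isClosed_closedBall.isCompact, hb⟩⟩
      · obtain ⟨m, -⟩ := hs y
        exact ⟨m, ∅, fun h => absurd h hy⟩
    choose m V hmV using this
    obtain ⟨t, htC, ht⟩ := hC.elim_nhds_subcover V fun y hy => (hmV y hy).2.1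
    refine ⟨t.image fun y => (V y, m y), ?_, ?_⟩
    · intro s hs'
      obtain ⟨y, hy, rfl⟩ := Finset.mem_image.1 hs'
      exact (hmV y (htC y hy)).2.2
    · intro x hx
      obtain ⟨y, hy, hxy⟩ := mem_iUnion₂.1 (ht hx)
      exact ⟨_, Finset.mem_image_of_mem _ hy, hxy, (hmV y (htC y hy)).1⟩
  let St : ℕ → Type _ := fun n => {S : Finset (Set X × M) //
    ∀ s ∈ S, IsCompact s.1 ∧ s.1 ⊆ f '' Metric.ball s.2 (c n)}
  have hstep : ∀ n (S : St n), ∃ S' : St (n + 1), ∀ s ∈ S.1, ∀ x ∈ s.1,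
      ∃ s' ∈ S'.1, x ∈ s'.1 ∧ dist s'.2 s.2 < c n := by
    rintro n ⟨S, hS⟩
    have : ∀ s : Set X × M, ∃ S' : Finset (Set X × M),
        (∀ s' ∈ S', IsCompact s'.1 ∧ s'.1 ⊆ f '' Metric.ball s'.2 (c (n + 1))) ∧
        (s ∈ S → ∀ x ∈ s.1, ∃ s' ∈ S', x ∈ s'.1 ∧ dist s'.2 s.2 < c n) := by
      intro s
      by_cases h : s ∈ S
      · obtain ⟨S', h1, h2⟩ := sub s.1 _ (c (n + 1)) (hc _) (hS s h).1 (hS s h).2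
        exact ⟨S', h1, fun _ => h2⟩
      · exact ⟨∅, by simp, fun h' => absurd h' h⟩
    choose D hD1 hD2 using this
    refine ⟨⟨S.biUnion D, ?_⟩, ?_⟩
    · intro s hs'
      obtain ⟨a, -, ha⟩ := Finset.mem_biUnion.1 hs'
      exact hD1 a s ha
    · intro s hs' x hx
      obtain ⟨s', h1, h2⟩ := hD2 s hs' x hx
      exact ⟨s', Finset.mem_biUnion.2 ⟨s, hs', h1⟩, h2⟩
  obtain ⟨S₀, hS₀, hS₀c⟩ := sub univ univ (c 0) (hc 0) isCompact_univ
    (by rw [image_univ, hs.range_eq])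
  choose nxt hnxt using hstep
  let seq : ∀ n, St n := fun n => Nat.rec (motive := St) ⟨S₀, hS₀⟩ (fun n s => nxt n s) n
  have hseq : ∀ n, ∀ s ∈ (seq n).1, ∀ x ∈ s.1,
      ∃ s' ∈ (seq (n + 1)).1, x ∈ s'.1 ∧ dist s'.2 s.2 < c n := fun n => hnxt n (seq n)
  have hc0 : Tendsto c atTop (𝓝 0) := by
    have := (tendsto_pow_atTop_nhds_zero_of_lt_one (r := (1 / 2 : ℝ)) (by norm_num)
      (by norm_num)).const_mul (1 / 2)
    simpa [hcdef, div_eq_mul_inv] using this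
  let K : Set M := ⋂ n, ⋃ s ∈ (seq n).1, Metric.closedBall s.2 (1 / 2 ^ n)
  have hKc : IsClosed K := isClosed_iInter fun n =>
    (seq n).1.finite_toSet.isClosed_biUnion fun s _ => Metric.isClosed_closedBall
  have hKt : TotallyBounded K := by
    refine Metric.totallyBounded_iff.2 fun ε hε => ?_
    obtain ⟨n, hn⟩ := exists_pow_lt_of_lt_one hε (by norm_num : (1 / 2 : ℝ) < 1)
    refine ⟨Prod.snd '' ((seq n).1 : Set (Set X × M)), (seq n).1.finite_toSet.image _, ?_⟩
    intro m hm
    obtain ⟨s, hs', hms⟩ := mem_iUnion₂.1 (mem_iInter.1 hm n)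
    refine mem_iUnion₂.2 ⟨s.2, ⟨s, hs', rfl⟩, ?_⟩
    have h2 : dist m s.2 ≤ 1 / 2 ^ n := hms
    rw [Metric.mem_ball]
    refine h2.trans_lt ?_
    simpa using hn
  refine ⟨K, isCompact_iff_totallyBounded_isComplete.2 ⟨hKt, hKc.isComplete⟩, eq_univ_of_forall fun x => ?_⟩
  let Br : ℕ → Type _ := fun n => {s : Set X × M // s ∈ (seq n).1 ∧ x ∈ s.1}
  have hbr : ∀ n (s : Br n), ∃ s' : Br (n + 1), dist s'.1.2 s.1.2 < c n := by
    rintro n ⟨s, h1, h2⟩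
    obtain ⟨s', a1, a2, a3⟩ := hseq n s h1 x h2
    exact ⟨⟨s', a1, a2⟩, a3⟩
  choose nb hnb using hbr
  obtain ⟨s₀, hs₀, hs₀x, -⟩ := hS₀c x (mem_univ x)
  let br : ∀ n, Br n := fun n => Nat.rec (motive := Br) ⟨s₀, hs₀, hs₀x⟩ (fun n s => nb n s) n
  have hd : ∀ n, dist (br n).1.2 (br (n + 1)).1.2 ≤ c n := fun n => by
    rw [dist_comm]; exact (hnb n (br n)).le
  obtain ⟨m, hm⟩ := cauchySeq_tendsto_of_complete (cauchySeq_of_le_geometric_two hd)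
  refine ⟨m, mem_iInter.2 fun n => mem_iUnion₂.2 ⟨(br n).1, (br n).2.1, ?_⟩, ?_⟩
  · rw [Metric.mem_closedBall, dist_comm]
    exact dist_le_of_le_geometric_two_of_tendsto hd hm n
  · have : ∀ n, ∃ q, dist q (br n).1.2 < c n ∧ f q = x := fun n => by
      obtain ⟨q, h1, h2⟩ := ((seq n).2 _ (br n).2.1).2 (br n).2.2
      exact ⟨q, h1, h2⟩
    choose q hq hqx using this
    have hqm : Tendsto q atTop (𝓝 m) := by
      refine tendsto_iff_dist_tendsto_zero.2 ?_
      have h3 : Tendsto (fun n => c n + dist (br n).1.2 m) atTop (𝓝 0) := by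
        simpa using hc0.add (tendsto_iff_dist_tendsto_zero.1 hm)
      exact squeeze_zero (fun _ => dist_nonneg)
        (fun n => (dist_triangle _ (br n).1.2 _).trans (by linarith [hq n])) h3
    have h4 := (hf.tendsto m).comp hqm
    have h5 : f ∘ q = fun _ => x := funext hqx
    rw [h5] at h4
    exact (tendsto_nhds_unique h4 tendsto_const_nhds)

lemma sep_bddAbove {Z : Type*} [PseudoMetricSpace Z] (S : Z → Z) (hS : Continuous S) (n : ℕ)
    {ε : ℝ} (hε : 0 < ε) {K : Set Z} (hK : IsCompact K) :
    BddAbove {m : ℕ | ∃ E : Finset Z, ↑E ⊆ K ∧ IsDynSep S n ε ↑E ∧ E.card = m} := by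
  classical
  let U : Z → Set Z := fun z => {w | ∀ j < n, dist (S^[j] w) (S^[j] z) < ε / 2}
  have hU : ∀ z, U z ∈ 𝓝 z := by
    intro z
    have : ∀ᶠ w in 𝓝 z, ∀ j ∈ Finset.range n, dist (S^[j] w) (S^[j] z) < ε / 2 :=
      (Finset.eventually_all _).2 fun j _ =>
        (hS.iterate j).continuousAt (Metric.ball_mem_nhds _ (half_pos hε))
    filter_upwards [this] with w hw j hj
    exact hw j (Finset.mem_range.2 hj)
  obtain ⟨t, -, ht⟩ := hK.elim_nhds_subcover U fun z _ => hU z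
  refine ⟨t.card, ?_⟩
  rintro _ ⟨E, hEK, hE, rfl⟩
  have : ∀ e : Z, ∃ z, e ∈ E → z ∈ t ∧ e ∈ U z := by
    intro e
    by_cases he : e ∈ E
    · obtain ⟨z, hz, hez⟩ := mem_iUnion₂.1 (ht (hEK he))
      exact ⟨z, fun _ => ⟨hz, hez⟩⟩
    · exact ⟨e, fun h => absurd h he⟩
  choose F hF using this
  refine Finset.card_le_card_of_injOn F (fun e he => (hF e he).1) ?_
  intro a ha b hb hab
  by_contra hne
  obtain ⟨j, hj, hlt⟩ := hE a ha b hb hne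
  have h1 := (hF a ha).2 j hj
  have h2 := (hF b hb).2 j hj
  rw [← hab] at h2
  have := dist_triangle_right (S^[j] a) (S^[j] b) (S^[j] (F a))
  linarith

lemma continuous_envMap {X : Type*} [TopologicalSpace X] (T : X ≃ₜ X) :
    Continuous (envMap T) := ContinuousMap.continuous_postcomp (T : C(X, X))

lemma envMap_iterate_apply {X : Type*} [TopologicalSpace X] (T : X ≃ₜ X) (j : ℕ) (φ : C(X, X))
    (x : X) : ((envMap T)^[j] φ) x = T^[j] (φ x) := by
  induction j with
  | zero => rfl
  | succ j ih =>
    rw [Function.iterate_succ_apply', Function.iterate_succ_apply', ← ih]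
    rfl

lemma entropyOnSet_le {Y Z : Type*} [PseudoMetricSpace Y] [PseudoMetricSpace Z] (S : Y → Y)
    (R : Z → Z) (K : Set Y) (L : Set Z)
    (h : ∀ n ε, 0 < ε → sepNum S n ε K ≤ sepNum R n ε L) :
    entropyOnSet S K ≤ entropyOnSet R L := by
  refine iSup₂_mono fun ε hε => limsup_le_limsup (Eventually.of_forall fun n => ?_)
  refine EReal.coe_le_coe_iff.2 (div_le_div_of_nonneg_right ?_ (Nat.cast_nonneg n))
  rcases Nat.eq_zero_or_pos (sepNum S n ε K) with h0 | h0
  · rw [h0]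
    simpa using Real.log_natCast_nonneg _
  · exact Real.log_le_log (by exact_mod_cast h0) (by exact_mod_cast h n ε hε)

/-- For a homeomorphism `T` of a homogeneous compact metric space, the entropy of the
functional envelope `(H(X,X), F_T)` is at least that of `(X,T)`. -/
theorem envelope_entropy_ge_of_homogeneous {X : Type*} [MetricSpace X] [CompactSpace X]
    (hhom : ∀ x y : X, ∃ f : X ≃ₜ X, f x = y) (T : X ≃ₜ X) :
    dynEntropy (⇑T) ≤ entropyOn (envMap T) (HSet X) := by
  classical
  refine iSup₂_le fun K hK => ?_
  suffices h : ∃ L : Set C(X, X), IsCompact L ∧ L ⊆ HSet X ∧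
      ∀ n ε, 0 < ε → sepNum T n ε K ≤ sepNum (envMap T) n ε L by
    obtain ⟨L, h1, h2, h3⟩ := h
    exact (entropyOnSet_le _ _ K L h3).trans
      (le_iSup_of_le L (le_iSup_of_le h1 (le_iSup_of_le h2 le_rfl)))
  rcases isEmpty_or_nonempty X with hX | ⟨⟨x₀⟩⟩
  · refine ⟨∅, isCompact_empty, empty_subset _, fun n ε hε => ?_⟩
    refine le_trans (le_of_eq ?_) (Nat.zero_le _)
    refine Nat.le_zero.1 (csSup_le' ?_)
    rintro _ ⟨E, -, -, rfl⟩
    simp [Finset.eq_empty_of_isEmpty E]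
  · have : Nonempty X := ⟨x₀⟩
    have hval : Continuous fun p : HPair X => p.1.1 := continuous_fst.comp continuous_subtype_val
    obtain ⟨M, hM, hMu⟩ := exists_compact_image_univ (fun q : HPair X => q.1.1 x₀)
      ((continuous_eval_const x₀).comp hval)
      (fun y => by
        obtain ⟨f, hf⟩ := hhom x₀ y
        exact ⟨HPair.ofHomeo f, hf⟩)
      (fun p ε hε => HPair.isOpen_ev hhom x₀ p hε)
    have hL : IsCompact ((fun p : HPair X => p.1.1) '' M) := hM.image hval
    refine ⟨_, hL, ?_, fun n ε hε => ?_⟩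
    · rintro _ ⟨p, -, rfl⟩
      exact (HPair.toHomeo p).isHomeomorph
    · refine csSup_le_csSup (sep_bddAbove _ (continuous_envMap T) n hε hL)
        ⟨0, ∅, by simp, by simp [IsDynSep], rfl⟩ ?_
      rintro _ ⟨E, hEK, hE, rfl⟩
      have : ∀ y : X, ∃ p ∈ M, p.1.1 x₀ = y := fun y => by
        have : y ∈ (fun q : HPair X => q.1.1 x₀) '' M := hMu ▸ mem_univ y
        exact this
      choose s hsM hs using this
      refine ⟨E.image fun y => (s y).1.1, ?_, ?_, ?_⟩
      · intro φ hφ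
        obtain ⟨y, hy, rfl⟩ := Finset.mem_image.1 (Finset.mem_coe.1 hφ)
        exact ⟨s y, hsM y, rfl⟩
      · intro φ hφ ψ hψ hne
        obtain ⟨y, hy, rfl⟩ := Finset.mem_image.1 (Finset.mem_coe.1 hφ)
        obtain ⟨z, hz, rfl⟩ := Finset.mem_image.1 (Finset.mem_coe.1 hψ)
        have hyz : y ≠ z := fun h => hne (by rw [h])
        obtain ⟨j, hj, hlt⟩ := hE y hy z hz hyz
        refine ⟨j, hj, hlt.trans_le ?_⟩
        have := ContinuousMap.dist_apply_le_dist (f := (envMap T)^[j] (s y).1.1)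
          (g := (envMap T)^[j] (s z).1.1) x₀
        rwa [envMap_iterate_apply, envMap_iterate_apply, hs, hs] at this
      · refine Finset.card_image_of_injective _ fun y z hyz => ?_
        rw [← hs y, ← hs z]
        exact congrArg (fun φ : C(X, X) => φ x₀) hyz
end

section
/- Let X be a Slovak space with minimal homeomorphism T generating its homeomorphism group. Then the map n ↦ T^n is a group isomorphism from ℤ onto the group of all self-homeomorphisms of X, and every self-homeomorphism of X other than the identity is minimal. -/
open Set Filter Topology

/-- Integer powers (iterates) of a self-homeomorphism: `hzpow T n = Tⁿ` for `n : ℤ`. -/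
def hzpow {X : Type*} [TopologicalSpace X] (T : X ≃ₜ X) : ℤ → (X ≃ₜ X)
  | Int.ofNat n => (fun S => S.trans T)^[n] (Homeomorph.refl X)
  | Int.negSucc n => ((fun S => S.trans T)^[n + 1] (Homeomorph.refl X)).symm

/-- A self-map of a topological space is minimal if every forward orbit is dense. -/
def IsMinimal {X : Type*} [TopologicalSpace X] (T : X → X) : Prop :=
  ∀ x : X, Dense (Set.range fun n : ℕ => T^[n] x)

lemma hzpow_eq_zpow {X : Type*} [TopologicalSpace X] (T : X ≃ₜ X) (n : ℤ) :
    hzpow T n = T ^ n := by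
  have key : ∀ n : ℕ, (fun S : X ≃ₜ X => S.trans T)^[n] (Homeomorph.refl X) = T ^ n := by
    intro n
    induction n with
    | zero => rfl
    | succ k ih =>
      rw [Function.iterate_succ_apply', ih, pow_succ']
      rfl
  cases n with
  | ofNat n => simpa [hzpow] using key n
  | negSucc n =>
    rw [zpow_negSucc, ← key (n + 1)]
    rfl

lemma homeo_pow_apply {X : Type*} [TopologicalSpace X] (T : X ≃ₜ X) (n : ℕ) (x : X) :
    (T ^ n) x = T^[n] x := by
  induction n with
  | zero => rfl
  | succ k ih => rw [Function.iterate_succ_apply', ← ih, pow_succ']; rfl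

/-- A closed forward invariant nonempty set of a minimal map is everything. -/
lemma minimal_closed_univ {X : Type*} [TopologicalSpace X] {T : X → X} (hmin : IsMinimal T)
    {A : Set X} (hA : IsClosed A) (hinv : ∀ x ∈ A, T x ∈ A) {x : X} (hx : x ∈ A) (y : X) :
    y ∈ A := by
  have h1 : range (fun n : ℕ => T^[n] x) ⊆ A := by
    rintro _ ⟨n, rfl⟩
    induction n with
    | zero => exact hx
    | succ k ih =>
      simp only [Function.iterate_succ_apply'] at ih ⊢
      exact hinv _ ih
  exact hA.closure_subset_iff.2 h1 (hmin x y)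

lemma zpow_eq_one_of_fix {X : Type*} [TopologicalSpace X] [T2Space X] (T : X ≃ₜ X)
    (hmin : IsMinimal ⇑T) (n : ℤ) {x : X} (hx : (T ^ n) x = x) : T ^ n = 1 := by
  ext y
  refine minimal_closed_univ hmin (A := {y | (T ^ n) y = y})
    (isClosed_eq (T ^ n).continuous continuous_id) ?_ hx y
  intro z hz
  have h : (T ^ n * T) z = (T * T ^ n) z := by rw [(Commute.zpow_self T n).eq]
  have h2 : (T ^ n) (T z) = T ((T ^ n) z) := h
  simp only [mem_ofPred_eq] at hz ⊢
  rw [h2, hz]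

lemma slovak_injective {X : Type*} [TopologicalSpace X] [T2Space X]
    (hcard : ∃ a b c : X, a ≠ b ∧ a ≠ c ∧ b ≠ c)
    (T : X ≃ₜ X) (hmin : IsMinimal ⇑T)
    (hgen : ∀ S : X ≃ₜ X, ∃ n : ℤ, S = T ^ n) (n : ℤ) (hn : T ^ n = 1) : n = 0 := by
  classical
  by_contra hne
  obtain ⟨a, b, c, hab, hac, hbc⟩ := hcard
  have hN : T ^ n.natAbs = 1 := by
    rcases Int.natAbs_eq n with h | h
    · rw [h, zpow_natCast] at hn; exact hn
    · rw [h, zpow_neg, zpow_natCast, inv_eq_one] at hn; exact hn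
  have hpos : 0 < n.natAbs := Int.natAbs_pos.2 hne
  have hfin : (range (fun m : ℕ => T^[m] c)).Finite := by
    refine ((Finset.range n.natAbs).finite_toSet.image (fun m : ℕ => T^[m] c)).subset ?_
    rintro _ ⟨m, rfl⟩
    refine ⟨m % n.natAbs, by simpa using Nat.mod_lt m hpos, ?_⟩
    simp only [← homeo_pow_apply]
    conv_rhs => rw [← Nat.mod_add_div m n.natAbs, pow_add, pow_mul, hN, one_pow, mul_one]
  have huniv : (univ : Set X).Finite := by
    rw [← (hmin c).closure_eq, hfin.isClosed.closure_eq]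
    exact hfin
  have : Finite X := finite_univ_iff.1 huniv
  have : DiscreteTopology X := inferInstance
  let S : X ≃ₜ X :=
    { toEquiv := Equiv.swap a b
      continuous_toFun := continuous_of_discreteTopology
      continuous_invFun := continuous_of_discreteTopology }
  obtain ⟨k, hk⟩ := hgen S
  have hc : S c = c := Equiv.swap_apply_of_ne_of_ne hac.symm hbc.symm
  have ha : S a = b := Equiv.swap_apply_left a b
  rw [hk] at hc
  rw [hk, zpow_eq_one_of_fix T hmin k hc] at ha
  exact hab ha

/-- Restriction of a homeomorphism to a clopen invariant set, extended by the identity. -/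
lemma exists_glue {X : Type*} [TopologicalSpace X] (S : X ≃ₜ X) (M : Set X) (hM : IsClopen M)
    (hSM : ∀ x, S x ∈ M ↔ x ∈ M) :
    ∃ R : X ≃ₜ X, (∀ x ∈ M, R x = S x) ∧ ∀ x ∉ M, R x = x := by
  classical
  have hSM' : ∀ x, S.symm x ∈ M ↔ x ∈ M := fun x => by
    rw [← hSM (S.symm x), S.apply_symm_apply]
  have hfr : ∀ f g : X → X, ∀ a ∈ frontier M, f a = g a := by
    intro f g a ha
    rw [hM.frontier_eq] at ha
    exact ha.elim
  refine ⟨{ toFun := M.piecewise S id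
            invFun := M.piecewise S.symm id
            left_inv := ?_
            right_inv := ?_
            continuous_toFun := Continuous.piecewise (hfr _ _) S.continuous continuous_id
            continuous_invFun :=
              Continuous.piecewise (hfr _ _) S.symm.continuous continuous_id }, ?_, ?_⟩
  · intro x
    by_cases hx : x ∈ M <;> simp [Set.piecewise, hx, hSM]
  · intro x
    by_cases hx : x ∈ M <;> simp [Set.piecewise, hx, hSM']
  · intro x hx
    exact Set.piecewise_eq_of_mem _ _ _ hx
  · intro x hx
    exact Set.piecewise_eq_of_notMem _ _ _ hx

/-- Existence of minimal closed invariant subsets. -/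
lemma exists_minimal_invariant {X : Type*} [TopologicalSpace X] [CompactSpace X]
    (S : X → X) (K : Set X) (hK : IsClosed K) (hne : K.Nonempty) (hinv : ∀ x ∈ K, S x ∈ K) :
    ∃ M ⊆ K, IsClosed M ∧ M.Nonempty ∧ (∀ x ∈ M, S x ∈ M) ∧
      ∀ A ⊆ M, IsClosed A → A.Nonempty → (∀ x ∈ A, S x ∈ A) → M ⊆ A := by
  obtain ⟨M, hMK, hM⟩ := zorn_superset_nonempty
    {A : Set X | IsClosed A ∧ A.Nonempty ∧ ∀ x ∈ A, S x ∈ A} (by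
      intro c hc hchain hcne
      have : Nonempty c := hcne.to_subtype
      refine ⟨⋂₀ c, ⟨isClosed_sInter fun A hA => (hc hA).1, ?_, ?_⟩,
        fun s hs => sInter_subset_of_mem hs⟩
      · refine IsCompact.nonempty_sInter_of_directed_nonempty_isCompact_isClosed ?_
          (fun A hA => (hc hA).2.1) (fun A hA => (hc hA).1.isCompact) (fun A hA => (hc hA).1)
        intro A hA B hB
        rcases hchain.total hA hB with h | h
        · exact ⟨A, hA, Subset.rfl, h⟩
        · exact ⟨B, hB, h, Subset.rfl⟩
      · intro x hx A hA
        exact (hc hA).2.2 x (hx A hA)) K ⟨hK, hne, hinv⟩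
  refine ⟨M, hMK, hM.prop.1, hM.prop.2.1, hM.prop.2.2, ?_⟩
  intro A hAM h1 h2 h3
  exact hM.le_of_le ⟨h1, h2, h3⟩ hAM

/-- If a nonzero power of a minimal homeomorphism is not minimal, there is a proper nonempty
clopen set invariant under that power. -/
lemma exists_clopen_invariant {X : Type*} [TopologicalSpace X] [T2Space X] [CompactSpace X]
    (T : X ≃ₜ X) (hmin : IsMinimal ⇑T) (k : ℤ) (hk : k ≠ 0)
    (hnot : ¬ IsMinimal ⇑(T ^ k)) :
    ∃ M : Set X, IsClopen M ∧ M.Nonempty ∧ (∃ y, y ∉ M) ∧ ∀ x, (T ^ k) x ∈ M ↔ x ∈ M := by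
  classical
  obtain ⟨S, hS⟩ : ∃ S, S = T ^ k := ⟨_, rfl⟩
  rw [← hS] at hnot ⊢
  have hcomm : ∀ (i : ℤ) (x : X), S ((T ^ i) x) = (T ^ i) (S x) := by
    intro i x
    have h : (S * T ^ i) x = (T ^ i * S) x := by
      rw [hS, ← zpow_add, ← zpow_add, add_comm]
    exact h
  unfold IsMinimal at hnot
  push Not at hnot
  obtain ⟨x, hx⟩ := hnot
  obtain ⟨y, hy⟩ : ∃ y, y ∉ closure (range fun n : ℕ => S^[n] x) := by
    simpa [Dense] using hx
  obtain ⟨M, hMK, hMc, hMne, hMi, hMmin⟩ := exists_minimal_invariant S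
    (closure (range fun n : ℕ => S^[n] x)) isClosed_closure
    ⟨x, subset_closure ⟨0, rfl⟩⟩ (by
      intro z hz
      refine map_mem_closure S.continuous hz ?_
      rintro _ ⟨n, rfl⟩
      exact ⟨n + 1, Function.iterate_succ_apply' _ _ _⟩)
  have hiff : ∀ z, S z ∈ M ↔ z ∈ M := by
    intro z
    refine ⟨fun hz => ?_, hMi z⟩
    have hsub : M ⊆ S '' M := by
      refine hMmin _ ?_ ((S.isClosed_image).2 hMc) (hMne.image _) ?_
      · rintro _ ⟨w, hw, rfl⟩
        exact hMi w hw
      · rintro _ ⟨w, hw, rfl⟩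
        exact ⟨S w, hMi w hw, rfl⟩
    obtain ⟨w, hw, hwz⟩ := hsub hz
    rwa [← S.injective hwz]
  have habs : ∀ z, z ∈ M → (T ^ k.natAbs) z ∈ M := by
    intro z hz
    rcases Int.natAbs_eq k with h | h
    · have h2 : T ^ k.natAbs = S := by rw [hS]; conv_rhs => rw [h, zpow_natCast]
      rw [h2]; exact hMi z hz
    · have h2 : T ^ k.natAbs = S⁻¹ := by
        rw [hS]; conv_rhs => rw [h, zpow_neg, zpow_natCast, inv_inv]
      rw [h2, ← hiff]
      have h3 : S (S⁻¹ z) = z := S.apply_symm_apply z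
      rwa [h3]
  have hpos : 0 < k.natAbs := Int.natAbs_pos.2 hk
  have hclosed : ∀ i : ℕ, IsClosed {z | (T ^ i) z ∈ M} := fun i =>
    hMc.preimage (T ^ i).continuous
  -- the translates cover the space
  have hcover : ∀ z, ∃ i < k.natAbs, (T ^ i) z ∈ M := by
    intro z
    obtain ⟨m, hm⟩ := hMne
    have hcl : IsClosed (⋃ i ∈ Finset.range k.natAbs, {z | (T ^ i) z ∈ M}) :=
      isClosed_biUnion_finset fun i _ => hclosed i
    have := minimal_closed_univ hmin hcl (x := m) (by
      intro w hw
      simp only [mem_iUnion, Finset.mem_range, mem_ofPred_eq, exists_prop] at hw ⊢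
      obtain ⟨i, hi, hiM⟩ := hw
      rcases i with _ | i
      · refine ⟨k.natAbs - 1, by omega, ?_⟩
        have h := habs w hiM
        rw [← Nat.sub_add_cancel hpos, pow_succ] at h
        exact h
      · refine ⟨i, by omega, ?_⟩
        rw [pow_succ] at hiM
        exact hiM) (by
      simp only [mem_iUnion, Finset.mem_range, mem_ofPred_eq, exists_prop]
      exact ⟨0, hpos, hm⟩) z
    simpa using this
  -- a translate that meets `M` is contained in `M`
  have htrans : ∀ i : ℕ, ∀ w, w ∈ M → (T ^ i) w ∈ M → ∀ z, (T ^ i) z ∈ M → z ∈ M := by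
    intro i w hw hiw z hz
    have hc2 : IsClosed {z | (T ^ (-(i : ℤ))) z ∈ M} :=
      hMc.preimage (T ^ (-(i : ℤ))).continuous
    have hinv : ∀ u, (T ^ (-(i : ℤ))) ((T ^ i) u) = u := by
      intro u
      have h : (T ^ (-(i : ℤ)) * T ^ i) u = u := by
        rw [zpow_neg, zpow_natCast, inv_mul_cancel]; rfl
      exact h
    have hsub := hMmin (M ∩ {z | (T ^ (-(i : ℤ))) z ∈ M}) inter_subset_left
      (hMc.inter hc2) ⟨(T ^ i) w, hiw, by simpa only [mem_ofPred_eq, hinv] using hw⟩ (by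
        rintro u ⟨hu, hu2⟩
        refine ⟨hMi u hu, ?_⟩
        simp only [mem_ofPred_eq] at hu2 ⊢
        rw [← hcomm]
        exact hMi _ hu2)
    have := (hsub hz).2
    simpa only [mem_ofPred_eq, hinv] using this
  refine ⟨M, ⟨hMc, ?_⟩, hMne, ⟨y, fun h => hy (hMK h)⟩, hiff⟩
  have hcompl : Mᶜ = ⋃ i ∈ (Finset.range k.natAbs).filter
      (fun i => ∀ w ∈ M, (T ^ i) w ∉ M), {z | (T ^ i) z ∈ M} := by
    ext z
    simp only [mem_compl_iff, mem_iUnion, Finset.mem_filter, Finset.mem_range, mem_ofPred_eq,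
      exists_prop]
    constructor
    · intro hz
      obtain ⟨i, hi, hiz⟩ := hcover z
      exact ⟨i, ⟨hi, fun w hw hiw => hz (htrans i w hw hiw z hiz)⟩, hiz⟩
    · rintro ⟨i, ⟨-, h⟩, hiz⟩ hz
      exact h z hz hiz
  rw [← isClosed_compl_iff, hcompl]
  exact isClosed_biUnion_finset fun i _ => hclosed i

/-- If `X` is a Slovak space with minimal generating homeomorphism `T`, then `n ↦ Tⁿ` is a
group isomorphism from `ℤ` onto the group of self-homeomorphisms of `X` (it is bijective and
sends addition to composition), and every self-homeomorphism other than the identity is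
minimal. -/
theorem slovak_homeo_group_iso {X : Type*} [MetricSpace X] [CompactSpace X]
    (hcard : ∃ a b c : X, a ≠ b ∧ a ≠ c ∧ b ≠ c)
    (T : X ≃ₜ X) (hmin : IsMinimal ⇑T)
    (hgen : ∀ S : X ≃ₜ X, ∃ n : ℤ, S = hzpow T n) :
    Function.Bijective (fun n : ℤ => hzpow T n) ∧
      (∀ m n : ℤ, hzpow T (m + n) = (hzpow T m).trans (hzpow T n)) ∧
      ∀ S : X ≃ₜ X, S ≠ Homeomorph.refl X → IsMinimal ⇑S := by
  have hz : hzpow T = fun n => T ^ n := funext (hzpow_eq_zpow T)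
  simp only [hz] at hgen ⊢
  have hinj := slovak_injective hcard T hmin hgen
  refine ⟨⟨?_, ?_⟩, ?_, ?_⟩
  · intro m n hmn
    have h : T ^ (m - n) = 1 := by
      rw [zpow_sub]
      exact mul_inv_eq_one.2 hmn
    exact sub_eq_zero.1 (hinj _ h)
  · intro S
    obtain ⟨n, hn⟩ := hgen S
    exact ⟨n, hn.symm⟩
  · intro m n
    rw [add_comm, zpow_add]
    rfl
  · intro S hS
    obtain ⟨k, rfl⟩ := hgen S
    by_contra hnot
    have hk : k ≠ 0 := by
      rintro rfl
      exact hS (zpow_zero T)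
    obtain ⟨M, hM, ⟨m, hm⟩, ⟨y, hy⟩, hiff⟩ := exists_clopen_invariant T hmin k hk hnot
    obtain ⟨R, hR1, hR2⟩ := exists_glue (T ^ k) M hM hiff
    obtain ⟨j, rfl⟩ := hgen R
    have hj := zpow_eq_one_of_fix T hmin j (hR2 y hy)
    have hm2 := hR1 m hm
    rw [hj] at hm2
    exact hk (hinj k (zpow_eq_one_of_fix T hmin k hm2.symm))
end

section
/- Let T : X → X be a homeomorphism of a compact metric space, x₀ ∈ X a point which is not periodic under T, and f : X∖{x₀} → [0,1] a continuous function. Let (a_n)_{n∈ℤ} be strictly positive reals with Σ_{n∈ℤ} a_n = 1, sup_{n∈ℤ} a_{n-1}/a_n < ∞ and sup_{n∈ℤ} a_n/a_{n-1} < ∞. Let X' = X ∖ {T^n x₀ : n ∈ ℤ}, F : X' → [0,1] given by F(x) = Σ_{n∈ℤ} a_n f(T^n x), and let F̃ ⊆ X × [0,1] be the closure of the graph of F. Then the map (x, F(x)) ↦ (T x, F(T x)) extends to a homeomorphism T̃ : F̃ → F̃ satisfying π ∘ T̃ = T ∘ π, where π : F̃ → X is the projection onto the first coordinate. Moreover,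 if T is minimal and X is infinite, then T̃ is minimal and the set of points z ∈ F̃ whose fiber π⁻¹(π(z)) is the singleton {z} is dense in F̃. -/
open Set Filter Topology

theorem hz_eq {X : Type*} [TopologicalSpace X] (T : X ≃ₜ X) (n : ℤ) (x : X) :
    hzpow T n x = ((T.toEquiv : Equiv.Perm X) ^ n) x := by
  have key : ∀ (k : ℕ) (x : X), ((fun S : X ≃ₜ X => S.trans T)^[k] (Homeomorph.refl X)) x
      = ((T.toEquiv : Equiv.Perm X) ^ k) x := by
    intro k
    induction k with
    | zero => intro x; simp
    | succ k ih =>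
      intro x
      rw [Function.iterate_succ_apply', pow_succ', Equiv.Perm.mul_apply, ← ih]
      rfl
  cases n with
  | ofNat n => simpa [hzpow] using key n x
  | negSucc n =>
    rw [zpow_negSucc]
    change ((fun S : X ≃ₜ X => S.trans T)^[n + 1] (Homeomorph.refl X)).symm x = _
    rw [Homeomorph.symm_apply_eq, key, ← Equiv.Perm.mul_apply, mul_inv_cancel, Equiv.Perm.one_apply]

/-- Extension of a bijection of `G` to a homeomorphism of its closure. -/
theorem extend_homeo {Y : Type*} [TopologicalSpace Y] [T3Space Y] (G : Set Y) (φ ψ : Y → Y)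
    (hφ : MapsTo φ G G) (hψ : MapsTo ψ G G)
    (h1 : ∀ p ∈ G, ψ (φ p) = p) (h2 : ∀ p ∈ G, φ (ψ p) = p)
    (lφ : ∀ p ∈ closure G, ∃ y, Tendsto φ (𝓝[G] p) (𝓝 y))
    (lψ : ∀ p ∈ closure G, ∃ y, Tendsto ψ (𝓝[G] p) (𝓝 y)) :
    ∃ S : (closure G : Set Y) ≃ₜ (closure G : Set Y), ∀ p : (closure G : Set Y),
      (p : Y) ∈ G → (S p : Y) = φ p := by
  have ext : ∀ χ : Y → Y, (∀ p ∈ closure G, ∃ y, Tendsto χ (𝓝[G] p) (𝓝 y)) →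
      ∀ p ∈ G, extendFrom G χ p = χ p := by
    intro χ l p hp
    obtain ⟨y, hy⟩ := l p (subset_closure hp)
    rw [extendFrom_eq (subset_closure hp) hy]
    have : Tendsto χ (pure p) (𝓝 y) := hy.mono_left (pure_le_nhdsWithin hp)
    exact tendsto_nhds_unique this (tendsto_pure_nhds χ p)
  have cφ : ContinuousOn (extendFrom G φ) (closure G) := continuousOn_extendFrom subset_rfl lφ
  have cψ : ContinuousOn (extendFrom G ψ) (closure G) := continuousOn_extendFrom subset_rfl lψ
  have maps : ∀ χ : Y → Y, MapsTo χ G G → (∀ p ∈ closure G, ∃ y, Tendsto χ (𝓝[G] p) (𝓝 y)) →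
      MapsTo (extendFrom G χ) (closure G) (closure G) := by
    intro χ hχ l
    refine MapsTo.closure_of_continuousOn ?_ (continuousOn_extendFrom subset_rfl l)
    intro p hp
    rw [ext χ l p hp]
    exact hχ hp
  have mφ := maps φ hφ lφ
  have mψ := maps ψ hψ lψ
  have comp : ∀ χ ξ : Y → Y, MapsTo χ G G → MapsTo (extendFrom G χ) (closure G) (closure G) →
      ContinuousOn (extendFrom G χ) (closure G) → ContinuousOn (extendFrom G ξ) (closure G) →
      (∀ p ∈ G, extendFrom G χ p = χ p) → (∀ p ∈ G, extendFrom G ξ p = ξ p) →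
      (∀ p ∈ G, ξ (χ p) = p) → ∀ p ∈ closure G, extendFrom G ξ (extendFrom G χ p) = p := by
    intro χ ξ hχ mχ cχ cξ eχ eξ h p hp
    have : EqOn (extendFrom G ξ ∘ extendFrom G χ) id (closure G) := by
      refine EqOn.of_subset_closure (s := G) ?_ (cξ.comp cχ mχ) continuousOn_id
        subset_closure subset_rfl
      intro p hp
      simp only [Function.comp, id]
      rw [eχ p hp, eξ _ (hχ hp), h p hp]
    exact this hp
  have i1 := comp φ ψ hφ mφ cφ cψ (ext φ lφ) (ext ψ lψ) h1
  have i2 := comp ψ φ hψ mψ cψ cφ (ext ψ lψ) (ext φ lφ) h2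
  refine ⟨{ toFun := mφ.restrict _ _ _
            invFun := mψ.restrict _ _ _
            left_inv := fun p => Subtype.ext (i1 p p.2)
            right_inv := fun p => Subtype.ext (i2 p p.2)
            continuous_toFun := cφ.mapsToRestrict mφ
            continuous_invFun := cψ.mapsToRestrict mψ }, ?_⟩
  intro p hp
  exact ext φ lφ p hp

theorem tendsto_series {X : Type*} [TopologicalSpace X] (T : X ≃ₜ X) (x₀ : X)
    (f : X → ℝ) (hfc : ContinuousOn f {x₀}ᶜ) [T1Space X]
    (hf01 : ∀ x : X, x ≠ x₀ → f x ∈ Set.Icc (0 : ℝ) 1)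
    (c : ℤ → ℝ) (hc : Summable c) (x : X) (hx : ∀ n, hzpow T n x = x₀ → c n = 0) :
    Tendsto (fun y => ∑' n : ℤ, c n * f (hzpow T n y)) (𝓝[{y | ∀ n, hzpow T n y ≠ x₀}] x)
      (𝓝 (∑' n : ℤ, c n * f (hzpow T n x))) := by
  refine tendsto_tsum_of_dominated_convergence (bound := fun n => |c n|) hc.abs ?_ ?_
  · intro n
    by_cases h : hzpow T n x = x₀
    · simp only [hx n h, zero_mul]
      exact tendsto_const_nhds
    · refine Tendsto.const_mul _ ?_
      have h1 : ContinuousAt f (hzpow T n x) :=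
        hfc.continuousAt (isOpen_compl_singleton.mem_nhds h)
      exact (h1.comp (hzpow T n).continuous.continuousAt).tendsto.mono_left nhdsWithin_le_nhds
  · filter_upwards [self_mem_nhdsWithin] with y hy n
    obtain ⟨h0, h1⟩ := hf01 _ (hy n)
    rw [Real.norm_eq_abs, abs_mul, abs_of_nonneg h0]
    exact mul_le_of_le_one_right (abs_nonneg _) h1

theorem summable_series {X : Type*} [TopologicalSpace X] (T : X ≃ₜ X) (x₀ : X)
    (f : X → ℝ) (hf01 : ∀ x : X, x ≠ x₀ → f x ∈ Set.Icc (0 : ℝ) 1)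
    (c : ℤ → ℝ) (hc : Summable c) (y : X) (hy : ∀ n, hzpow T n y ≠ x₀) :
    Summable (fun n : ℤ => c n * f (hzpow T n y)) := by
  refine Summable.of_norm_bounded (g := fun n => |c n|) hc.abs ?_
  intro n
  obtain ⟨h0, h1⟩ := hf01 _ (hy n)
  rw [Real.norm_eq_abs, abs_mul, abs_of_nonneg h0]
  exact mul_le_of_le_one_right (abs_nonneg _) h1

theorem hz_inj {X : Type*} [TopologicalSpace X] (T : X ≃ₜ X) (x₀ : X)
    (hper : ∀ k : ℕ, 1 ≤ k → (⇑T)^[k] x₀ ≠ x₀) (x : X) (m n : ℤ)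
    (hm : hzpow T m x = x₀) (hn : hzpow T n x = x₀) : m = n := by
  have aux : ∀ m n : ℤ, hzpow T m x = x₀ → hzpow T n x = x₀ → ¬ m < n := by
    intro m n hm hn hlt
    obtain ⟨k, hk⟩ := Int.eq_ofNat_of_zero_le (sub_nonneg.2 hlt.le)
    apply hper k (by omega)
    have : n = (k : ℤ) + m := by omega
    rw [hz_eq] at hm hn
    rw [this, zpow_add, Equiv.Perm.mul_apply, hm, zpow_natCast] at hn
    rw [← Equiv.Perm.iterate_eq_pow] at hn
    exact hn
  have := aux m n hm hn
  have := aux n m hn hm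
  omega

/-- Under the assumptions of the uniform-continuity lemma, with both ratios `a_{n-1}/a_n` and
`a_n/a_{n-1}` bounded, the map `(x, F x) ↦ (T x, F (T x))` extends to a homeomorphism `T̃` of
the closure `F̃` of the graph of `F`, commuting with the first-coordinate projection `π`
(`π ∘ T̃ = T ∘ π`).  Moreover, if `T` is minimal and `X` is infinite, then `T̃` is minimal and
the set of points of `F̃` which are alone in their `π`-fiber is dense in `F̃`. -/
theorem graph_closure_homeomorph {X : Type*} [MetricSpace X] [CompactSpace X]
    (T : X ≃ₜ X) (x₀ : X) (hper : ∀ k : ℕ, 1 ≤ k → (⇑T)^[k] x₀ ≠ x₀)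
    (f : X → ℝ) (hfc : ContinuousOn f {x₀}ᶜ)
    (hf01 : ∀ x : X, x ≠ x₀ → f x ∈ Set.Icc (0 : ℝ) 1)
    (a : ℤ → ℝ) (hapos : ∀ n : ℤ, 0 < a n) (hsummable : Summable a)
    (hsum : ∑' n : ℤ, a n = 1)
    (hratio : ∃ A : ℝ, ∀ n : ℤ, a (n - 1) / a n ≤ A)
    (hratio' : ∃ A : ℝ, ∀ n : ℤ, a n / a (n - 1) ≤ A) :
    ∀ (F : X → ℝ) (G : Set (X × ℝ)),
      F = (fun x => ∑' n : ℤ, a n * f (hzpow T n x)) →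
      G = {p : X × ℝ | (∀ n : ℤ, hzpow T n x₀ ≠ p.1) ∧ p.2 = F p.1} →
      ∃ S : (closure G : Set (X × ℝ)) ≃ₜ (closure G : Set (X × ℝ)),
        (∀ p : (closure G : Set (X × ℝ)), (p : X × ℝ) ∈ G →
          (S p : X × ℝ) = (T (p : X × ℝ).1, F (T (p : X × ℝ).1))) ∧
        (∀ p : (closure G : Set (X × ℝ)), (S p : X × ℝ).1 = T (p : X × ℝ).1) ∧
        (IsMinimal ⇑T → Infinite X →
          IsMinimal ⇑S ∧
            Dense {p : (closure G : Set (X × ℝ)) |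
              ∀ q : (closure G : Set (X × ℝ)), (q : X × ℝ).1 = (p : X × ℝ).1 → q = p}) := by
  intro F G hF hG
  -- reformulation of the orbit condition
  have horb : ∀ x : X, (∀ n : ℤ, hzpow T n x₀ ≠ x) ↔ ∀ n : ℤ, hzpow T n x ≠ x₀ := by
    intro x
    constructor
    · intro h n hn
      apply h (-n)
      rw [← hn, hz_eq, hz_eq, zpow_neg, ← Equiv.Perm.mul_apply, inv_mul_cancel, Equiv.Perm.one_apply]
    · intro h n hn
      apply h (-n)
      rw [← hn, hz_eq, hz_eq, zpow_neg, ← Equiv.Perm.mul_apply, inv_mul_cancel, Equiv.Perm.one_apply]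
  have hG' : ∀ p : X × ℝ, p ∈ G ↔ (∀ n : ℤ, hzpow T n p.1 ≠ x₀) ∧ p.2 = F p.1 := by
    intro p
    rw [hG, ← horb]
    rfl
  have hfst : ∀ p : X × ℝ, Tendsto Prod.fst (𝓝[G] p) (𝓝[{y | ∀ n, hzpow T n y ≠ x₀}] p.1) := by
    intro p
    refine tendsto_nhdsWithin_iff.2 ⟨continuous_fst.continuousAt.mono_left nhdsWithin_le_nhds, ?_⟩
    filter_upwards [self_mem_nhdsWithin] with q hq using ((hG' q).1 hq).1
  have hsnd : ∀ p : X × ℝ, Tendsto (fun q : X × ℝ => F q.1) (𝓝[G] p) (𝓝 p.2) := by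
    intro p
    have : Tendsto Prod.snd (𝓝[G] p) (𝓝 p.2) :=
      continuous_snd.continuousAt.mono_left nhdsWithin_le_nhds
    refine this.congr' ?_
    filter_upwards [self_mem_nhdsWithin] with q hq using ((hG' q).1 hq).2
  -- existence of limits for every shifted series
  have hlim : ∀ b : ℤ → ℝ, Summable b → ∀ p : X × ℝ, ∃ t : ℝ,
      Tendsto (fun q : X × ℝ => ∑' n : ℤ, b n * f (hzpow T n q.1)) (𝓝[G] p) (𝓝 t) := by
    intro b hb p
    obtain ⟨r, hr⟩ : ∃ r : ℝ, ∀ n, hzpow T n p.1 = x₀ → b n - r * a n = 0 := by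
      by_cases h : ∃ m, hzpow T m p.1 = x₀
      · obtain ⟨m, hm⟩ := h
        refine ⟨b m / a m, fun n hn => ?_⟩
        rw [hz_inj T x₀ hper p.1 n m hn hm, div_mul_cancel₀ _ (hapos m).ne', sub_self]
      · push Not at h
        exact ⟨0, fun n hn => absurd hn (h n)⟩
    have hcs : Summable (fun n => b n - r * a n) := hb.sub (hsummable.mul_left r)
    have h1 := (tendsto_series T x₀ f hfc hf01 _ hcs p.1 hr).comp (hfst p)
    have h2 := h1.add ((hsnd p).const_mul r)
    refine ⟨_, h2.congr' ?_⟩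
    filter_upwards [self_mem_nhdsWithin] with q hq
    have hq' := ((hG' q).1 hq).1
    have s1 := summable_series T x₀ f hf01 _ hcs q.1 hq'
    have s2 := summable_series T x₀ f hf01 _ hsummable q.1 hq'
    simp only [Function.comp, hF]
    rw [← tsum_mul_left, ← s1.tsum_add (s2.mul_left r)]
    refine tsum_congr fun n => ?_
    ring
  have hFT : ∀ x, F (T x) = ∑' n : ℤ, a (n - 1) * f (hzpow T n x) := by
    intro x
    rw [hF, ← (Equiv.addRight (1 : ℤ)).tsum_eq (fun n : ℤ => a (n - 1) * f (hzpow T n x))]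
    refine tsum_congr fun n => ?_
    simp only [Equiv.coe_addRight, add_sub_cancel_right, hz_eq]
    rw [zpow_add_one, Equiv.Perm.mul_apply]
    rfl
  have hFT' : ∀ x, F (T.symm x) = ∑' n : ℤ, a (n + 1) * f (hzpow T n x) := by
    intro x
    rw [hF]
    change ∑' n : ℤ, a n * f (hzpow T n (T.symm x)) = _
    rw [← (Equiv.addRight (1 : ℤ)).tsum_eq (fun n : ℤ => a n * f (hzpow T n (T.symm x)))]
    refine tsum_congr fun n => ?_
    simp only [Equiv.coe_addRight, hz_eq]
    rw [zpow_add_one, Equiv.Perm.mul_apply]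
    congr 3
    exact T.apply_symm_apply x
  have hT1 : ∀ x, (∀ n : ℤ, hzpow T n x ≠ x₀) → ∀ n : ℤ, hzpow T n (T x) ≠ x₀ := by
    intro x h n hn
    apply h (n + 1)
    rw [hz_eq] at hn ⊢
    rw [zpow_add_one, Equiv.Perm.mul_apply]
    exact hn
  have hT2 : ∀ x, (∀ n : ℤ, hzpow T n x ≠ x₀) → ∀ n : ℤ, hzpow T n (T.symm x) ≠ x₀ := by
    intro x h n hn
    apply h (n - 1)
    rw [hz_eq] at hn ⊢
    rw [zpow_sub_one, Equiv.Perm.mul_apply]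
    exact hn
  obtain ⟨S, hS⟩ := extend_homeo G (fun p => (T p.1, F (T p.1)))
    (fun p => (T.symm p.1, F (T.symm p.1)))
    (fun p hp => (hG' _).2 ⟨hT1 _ ((hG' p).1 hp).1, rfl⟩)
    (fun p hp => (hG' _).2 ⟨hT2 _ ((hG' p).1 hp).1, rfl⟩)
    (fun p hp => by
      refine Prod.ext (by simp) ?_
      simpa using ((hG' p).1 hp).2.symm)
    (fun p hp => by
      refine Prod.ext (by simp) ?_
      simpa using ((hG' p).1 hp).2.symm)
    (fun p _ => by
      obtain ⟨t, ht⟩ := hlim (fun n => a (n - 1))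
        ((Equiv.subRight (1 : ℤ)).summable_iff.2 hsummable) p
      refine ⟨(T p.1, t), ?_⟩
      refine Tendsto.prodMk_nhds ?_ ?_
      · exact (T.continuous.comp continuous_fst).continuousAt.mono_left nhdsWithin_le_nhds
      · simpa only [hFT] using ht)
    (fun p _ => by
      obtain ⟨t, ht⟩ := hlim (fun n => a (n + 1))
        ((Equiv.addRight (1 : ℤ)).summable_iff.2 hsummable) p
      refine ⟨(T.symm p.1, t), ?_⟩
      refine Tendsto.prodMk_nhds ?_ ?_
      · exact (T.symm.continuous.comp continuous_fst).continuousAt.mono_left nhdsWithin_le_nhds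
      · simpa only [hFT'] using ht)
  have hdense : Dense {p : (closure G : Set (X × ℝ)) | (p : X × ℝ) ∈ G} := by
    intro p
    rw [closure_subtype]
    have : ((↑) '' {p : (closure G : Set (X × ℝ)) | (p : X × ℝ) ∈ G} : Set (X × ℝ)) = G := by
      ext q
      constructor
      · rintro ⟨r, hr, rfl⟩
        exact hr
      · intro hq
        exact ⟨⟨q, subset_closure hq⟩, hq, rfl⟩
    rw [this]
    exact p.2
  have hproj : ∀ p : (closure G : Set (X × ℝ)), (S p : X × ℝ).1 = T (p : X × ℝ).1 := by
    have : (fun p : (closure G : Set (X × ℝ)) => (S p : X × ℝ).1)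
        = fun p : (closure G : Set (X × ℝ)) => T (p : X × ℝ).1 := by
      refine Continuous.ext_on hdense (by fun_prop) (by fun_prop) ?_
      intro p hp
      simp only [hS p hp]
    exact fun p => congrFun this p
  -- fibres over points outside the orbit
  have hfib : ∀ p ∈ closure G, (∀ n : ℤ, hzpow T n p.1 ≠ x₀) → p.2 = F p.1 := by
    intro p hp hx
    have : (𝓝[G] p).NeBot := mem_closure_iff_nhdsWithin_neBot.1 hp
    have h1 := (tendsto_series T x₀ f hfc hf01 a hsummable p.1
      (fun n hn => absurd hn (hx n))).comp (hfst p)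
    have h2 := hsnd p
    rw [hF] at h2 ⊢
    exact tendsto_nhds_unique h2 h1
  refine ⟨S, hS, hproj, fun hmin _ => ⟨?_, ?_⟩⟩
  · have hcomp : IsCompact (closure G) := by
      refine (isCompact_univ.prod (isCompact_Icc (a := (0 : ℝ)) (b := 1))).closure_of_subset ?_
      intro p hp
      obtain ⟨hx, hp2⟩ := (hG' p).1 hp
      refine ⟨mem_univ _, ?_⟩
      rw [hp2, hF]
      have s := summable_series T x₀ f hf01 a hsummable p.1 hx
      constructor
      · exact tsum_nonneg fun n => mul_nonneg (hapos n).le (hf01 _ (hx n)).1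
      · rw [← hsum]
        exact s.tsum_le_tsum
          (fun n => mul_le_of_le_one_right (hapos n).le (hf01 _ (hx n)).2) hsummable
    have : CompactSpace (closure G : Set (X × ℝ)) := isCompact_iff_compactSpace.1 hcomp
    intro p
    set O := Set.range fun n : ℕ => (⇑S)^[n] p with hO
    let π : ↥(closure G) → X := fun q => (q : X × ℝ).1
    have hπ : Continuous π := by fun_prop
    have himg : π '' closure O = univ := by
      have hcl : IsClosed (π '' closure O) := (isClosed_closure.isCompact.image hπ).isClosed
      refine eq_univ_of_univ_subset ?_
      rw [← (hmin (π p)).closure_eq]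
      refine closure_minimal ?_ hcl
      rintro _ ⟨n, rfl⟩
      refine ⟨(⇑S)^[n] p, subset_closure ⟨n, rfl⟩, ?_⟩
      exact (Function.Semiconj.iterate_right (f := π) hproj n) p
    rw [dense_iff_closure_eq]
    refine eq_univ_of_univ_subset ?_
    rw [← hdense.closure_eq]
    refine closure_minimal ?_ isClosed_closure
    intro q hq
    obtain ⟨r, hr, hrq⟩ : π q ∈ π '' closure O := himg ▸ mem_univ _
    have hrq' : (r : X × ℝ).1 = (q : X × ℝ).1 := hrq
    obtain ⟨hx, hq2⟩ := (hG' q).1 hq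
    have : r = q := by
      refine Subtype.ext (Prod.ext hrq' ?_)
      rw [hq2, hfib r r.2 (by rw [hrq']; exact hx), hrq']
    exact this ▸ hr
  · refine hdense.mono ?_
    intro p hp q hq
    obtain ⟨hx, hp2⟩ := (hG' p).1 hp
    refine Subtype.ext (Prod.ext hq ?_)
    rw [hp2, hfib q q.2 (by rw [hq]; exact hx), hq]
end
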